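/- Let λ₁ > 0, λ₂ > 0, and b ∈ ℝ. Define H₂(x) := (λ₁/2)(x₁² − x₃²) + (λ₂/2)(x₂² + x₄²) and the vector field Y₂(x) := ((1 − b)x₁, x₂/2, b·x₃, x₄/2) on ℝ⁴. Then for every x ∈ ℝ⁴: ⟨∇H₂(x), Y₂(x)⟩ = H₂(x) + λ₁(1/2 − b)(x₁² + x₃²). Consequently, if 0 < b ≤ 1/2 and c₀ > 0, then ⟨∇H₂(x), Y₂(x)⟩ ≥ c₀ > 0 for every x with H₂(x) = c₀, i.e. the vector field Y₂ is transverse to the level set H₂⁻¹(c₀). -/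

import Mathlib

open scoped RealInnerProductSpace

/-- The derivative of the quadratic form `p(x₁² − x₃²) + q(x₂² + x₄²)` on `ℝ⁴`, evaluated along
a vector `v`, in the form of the pairing with the gradient. -/
theorem inner_gradient_saddleCenter (p q : ℝ) (x v : EuclideanSpace ℝ (Fin 4)) :
    ⟪gradient (fun y : EuclideanSpace ℝ (Fin 4) =>
      p * ((y 0)^2 - (y 2)^2) + q * ((y 1)^2 + (y 3)^2)) x, v⟫ =
      2 * p * (x 0 * v 0 - x 2 * v 2) + 2 * q * (x 1 * v 1 + x 3 * v 3) := by
  have hc (i : Fin 4) : HasFDerivAt (fun y : EuclideanSpace ℝ (Fin 4) => y i)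
      (EuclideanSpace.proj i : EuclideanSpace ℝ (Fin 4) →L[ℝ] ℝ) x :=
    (EuclideanSpace.proj i : EuclideanSpace ℝ (Fin 4) →L[ℝ] ℝ).hasFDerivAt
  have hf := ((((hc 0).pow 2).sub ((hc 2).pow 2)).const_mul p).add
    ((((hc 1).pow 2).add ((hc 3).pow 2)).const_mul q)
  rw [gradient, InnerProductSpace.toDual_symm_apply]
  refine (congrArg (fun L : EuclideanSpace ℝ (Fin 4) →L[ℝ] ℝ => L v) hf.fderiv).trans ?_
  simp
  ring

/-- The Liouville vector field `Y₂ = ((1−b)x₁, x₂/2, bx₃, x₄/2)` pairs with the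
gradient of `H₂ = (λ₁/2)(x₁² − x₃²) + (λ₂/2)(x₂² + x₄²)` as
`⟨∇H₂, Y₂⟩ = H₂ + λ₁(1/2 − b)(x₁² + x₃²)`; hence for `0 < b ≤ 1/2` it is
transverse to every positive level set `H₂ = c₀ > 0`. -/
theorem liouville_transversality (lam₁ lam₂ b : ℝ) (h1 : 0 < lam₁) (h2 : 0 < lam₂) :
    let H₂ : EuclideanSpace ℝ (Fin 4) → ℝ := fun x =>
      lam₁ / 2 * ((x 0)^2 - (x 2)^2) + lam₂ / 2 * ((x 1)^2 + (x 3)^2)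
    let Y₂ : EuclideanSpace ℝ (Fin 4) → EuclideanSpace ℝ (Fin 4) := fun x =>
      (EuclideanSpace.equiv (Fin 4) ℝ).symm
        ![(1 - b) * x 0, x 1 / 2, b * x 2, x 3 / 2]
    (∀ x : EuclideanSpace ℝ (Fin 4),
      ⟪gradient H₂ x, Y₂ x⟫ = H₂ x + lam₁ * (1/2 - b) * ((x 0)^2 + (x 2)^2)) ∧
    (0 < b → b ≤ 1/2 → ∀ c₀ : ℝ, 0 < c₀ → ∀ x : EuclideanSpace ℝ (Fin 4),
      H₂ x = c₀ → c₀ ≤ ⟪gradient H₂ x, Y₂ x⟫) := by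
  intro H₂ Y₂
  have key (x : EuclideanSpace ℝ (Fin 4)) :
      ⟪gradient H₂ x, Y₂ x⟫ = H₂ x + lam₁ * (1/2 - b) * ((x 0)^2 + (x 2)^2) := by
    rw [inner_gradient_saddleCenter]
    simp [H₂, Y₂]
    ring
  refine ⟨key, fun _ hb c₀ _ x hx => ?_⟩
  rw [key, hx]
  have : 0 ≤ 1/2 - b := sub_nonneg.2 hb
  exact le_add_of_nonneg_right (by positivity)
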